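/- Let G be the 8 × 8 real symmetric matrix with all diagonal entries equal to 1 and off-diagonal entries (symmetrically extended) G₁₂ = −1, G₁₃ = −√5/2, G₂₄ = −√5/2, G₃₅ = −1/2, G₄₈ = −1/2, G₅₆ = −√2/2, G₆₇ = −1/2, G₇₈ = −√2/2, and all other off-diagonal entries 0. Then G has exactly 5 positive eigenvalues (with multiplicity), exactly 1 negative eigenvalue, and exactly 2 zero eigenvalues; equivalently G has rank 6 and signature (5,1). -/

import Mathlib

open Real

noncomputable def G9 : Matrix (Fin 8) (Fin 8) ℝ :=
  !![1, -1, -(Real.sqrt 5 / 2), 0, 0, 0, 0, 0;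
     -1, 1, 0, -(Real.sqrt 5 / 2), 0, 0, 0, 0;
     -(Real.sqrt 5 / 2), 0, 1, 0, -(1/2), 0, 0, 0;
     0, -(Real.sqrt 5 / 2), 0, 1, 0, 0, 0, -(1/2);
     0, 0, -(1/2), 0, 1, -(Real.sqrt 2 / 2), 0, 0;
     0, 0, 0, 0, -(Real.sqrt 2 / 2), 1, -(1/2), 0;
     0, 0, 0, 0, 0, -(1/2), 1, -(Real.sqrt 2 / 2);
     0, 0, 0, -(1/2), 0, 0, -(Real.sqrt 2 / 2), 1]

set_option maxHeartbeats 4000000 in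
theorem det_gram_pencil {R : Type*} [CommRing R] (x a b c : R) :
    Matrix.det !![x, 1, a, 0, 0, 0, 0, 0;
     1, x, 0, a, 0, 0, 0, 0;
     a, 0, x, 0, b, 0, 0, 0;
     0, a, 0, x, 0, 0, 0, b;
     0, 0, b, 0, x, c, 0, 0;
     0, 0, 0, 0, c, x, b, 0;
     0, 0, 0, 0, 0, b, x, c;
     0, 0, 0, b, 0, 0, c, x] =
    ((x + 1) * (x * (x * (x + b) - c ^ 2) - b ^ 2 * (x + b)) - a ^ 2 * (x * (x + b) - c ^ 2)) *
    ((x - 1) * (x * (x * (x - b) - c ^ 2) - b ^ 2 * (x - b)) - a ^ 2 * (x * (x - b) - c ^ 2)) := by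
  simp [Matrix.det_succ_row_zero, Fin.sum_univ_succ, Fin.succAbove]
  ring

theorem charpoly_G9 : G9.charpoly =
    (({0, 0, 2, 2, (1 + √17) / 4, (1 - √17) / 4, (7 + √17) / 4, (7 - √17) / 4} :
      Multiset ℝ).map fun r => Polynomial.X - Polynomial.C r).prod := by
  refine Polynomial.funext fun t => ?_
  have pencil : Matrix.scalar (Fin 8) t - G9 =
      !![t - 1, 1, √5 / 2, 0, 0, 0, 0, 0;
         1, t - 1, 0, √5 / 2, 0, 0, 0, 0;
         √5 / 2, 0, t - 1, 0, 1 / 2, 0, 0, 0;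
         0, √5 / 2, 0, t - 1, 0, 0, 0, 1 / 2;
         0, 0, 1 / 2, 0, t - 1, √2 / 2, 0, 0;
         0, 0, 0, 0, √2 / 2, t - 1, 1 / 2, 0;
         0, 0, 0, 0, 0, 1 / 2, t - 1, √2 / 2;
         0, 0, 0, 1 / 2, 0, 0, √2 / 2, t - 1] := by
    ext i j
    fin_cases i <;> fin_cases j <;> simp [G9]
  have even_factors : (t - (1 + √17) / 4) * (t - (1 - √17) / 4) = t ^ 2 - t / 2 - 1 := by
    linear_combination (-1 / 16) * Real.sq_sqrt (show (0 : ℝ) ≤ 17 by norm_num)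
  have odd_factors : (t - (7 + √17) / 4) * (t - (7 - √17) / 4) = t ^ 2 - 7 * t / 2 + 2 := by
    linear_combination (-1 / 16) * Real.sq_sqrt (show (0 : ℝ) ≤ 17 by norm_num)
  rw [Matrix.eval_charpoly, pencil, det_gram_pencil, div_pow √2, div_pow √5,
    Real.sq_sqrt (by norm_num), Real.sq_sqrt (by norm_num)]
  trans t * (t * ((t - 2) * ((t - 2) * ((t ^ 2 - t / 2 - 1) * (t ^ 2 - 7 * t / 2 + 2)))))
  · ring
  · rw [← even_factors, ← odd_factors]
    simp [mul_assoc]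

theorem eigenvalues_G9 (hG : G9.IsHermitian) :
    Finset.univ.val.map hG.eigenvalues =
      {0, 0, 2, 2, (1 + √17) / 4, (1 - √17) / 4, (7 + √17) / 4, (7 - √17) / 4} := by
  have h := hG.roots_charpoly_eq_eigenvalues
  rw [charpoly_G9, Polynomial.roots_multiset_prod_X_sub_C] at h
  exact h.symm

theorem card_filter_eigenvalues_G9 (hG : G9.IsHermitian) (p : ℝ → Prop) [DecidablePred p] :
    (Finset.univ.filter fun j => p (hG.eigenvalues j)).card =
      Multiset.countP p
        {0, 0, 2, 2, (1 + √17) / 4, (1 - √17) / 4, (7 + √17) / 4, (7 - √17) / 4} := by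
  rw [← eigenvalues_G9 hG, Multiset.countP_map]
  rfl

theorem stmt_9 (hG : G9.IsHermitian) :
    (Finset.univ.filter fun j => 0 < hG.eigenvalues j).card = 5 ∧
    (Finset.univ.filter fun j => hG.eigenvalues j < 0).card = 1 ∧
    (Finset.univ.filter fun j => hG.eigenvalues j = 0).card = 2 ∧
    G9.rank = 6 := by
  have lower : 1 < √17 := by rw [Real.lt_sqrt] <;> norm_num
  have upper : √17 < 7 := by rw [Real.sqrt_lt'] <;> norm_num
  have h₁ : 0 < (1 + √17) / 4 := by linarith
  have h₂ : (1 - √17) / 4 < 0 := by linarith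
  have h₃ : 0 < (7 + √17) / 4 := by linarith
  have h₄ : 0 < (7 - √17) / 4 := by linarith
  refine ⟨?_, ?_, ?_, ?_⟩
  · rw [card_filter_eigenvalues_G9 hG (0 < ·)]
    simp only [Multiset.insert_eq_cons, ← Multiset.cons_zero, Multiset.countP_cons,
      Multiset.countP_zero, h₁, h₃, h₄, h₂.not_gt]
    norm_num
  · rw [card_filter_eigenvalues_G9 hG (· < 0)]
    simp only [Multiset.insert_eq_cons, ← Multiset.cons_zero, Multiset.countP_cons,
      Multiset.countP_zero, h₁.not_gt, h₃.not_gt, h₄.not_gt, h₂]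
    norm_num
  · rw [card_filter_eigenvalues_G9 hG (· = 0)]
    simp only [Multiset.insert_eq_cons, ← Multiset.cons_zero, Multiset.countP_cons,
      Multiset.countP_zero, h₁.ne', h₃.ne', h₄.ne', h₂.ne]
    norm_num
  · rw [hG.rank_eq_card_non_zero_eigs, Fintype.card_subtype,
      card_filter_eigenvalues_G9 hG (· ≠ 0)]
    simp only [Multiset.insert_eq_cons, ← Multiset.cons_zero, Multiset.countP_cons,
      Multiset.countP_zero, ne_eq, h₁.ne', h₃.ne', h₄.ne', h₂.ne]
    norm_num
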